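/- Let S be an admissible additive subsemigroup of ℤ^n × ℤ. Then the sets Conv(S^{k!}) are nondecreasing in k, and the interior of Δ(S) satisfies interior(Δ(S)) = ⋃_{k≥1} interior(Conv(S^k)) = ⋃_{k≥1} interior(Conv(S^{k!})). -/

import Mathlib

open Set

noncomputable section

/-- The embedding of the lattice `ℤ^n × ℤ` into `ℝ^n × ℝ`. -/
def latticeEmbed {n : ℕ} (x : (Fin n → ℤ) × ℤ) : (Fin n → ℝ) × ℝ :=
  (fun i => (x.1 i : ℝ), (x.2 : ℝ))

/-- The set of all finite nonnegative linear combinations of elements of `T`. -/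
def coneCombos {E : Type*} [AddCommMonoid E] [Module ℝ E] (T : Set E) : Set E :=
  {x | ∃ (k : ℕ) (c : Fin k → ℝ) (t : Fin k → E),
    (∀ i, 0 ≤ c i) ∧ (∀ i, t i ∈ T) ∧ x = ∑ i, c i • t i}

/-- `C(T)`: the closed convex cone generated by `T`. -/
def closedConeHull {E : Type*} [AddCommMonoid E] [Module ℝ E] [TopologicalSpace E]
    (T : Set E) : Set E :=
  closure (coneCombos T)

/-- The closed convex cone `C(S) ⊆ ℝ^{n+1}` generated by a subset `S ⊆ ℤ^n × ℤ`. -/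
def coneOf {n : ℕ} (S : Set ((Fin n → ℤ) × ℤ)) : Set ((Fin n → ℝ) × ℝ) :=
  closedConeHull (latticeEmbed '' S)

/-- The Okounkov convex set `Δ(S) = π(C(S) ∩ (ℝ^n × {1}))`. -/
def okounkovSet {n : ℕ} (S : Set ((Fin n → ℤ) × ℤ)) : Set (Fin n → ℝ) :=
  Prod.fst '' (coneOf S ∩ {x | x.2 = 1})

/-- `S^k = {α ∈ ℝ^n : kα ∈ ℤ^n and (kα, k) ∈ S}`. -/
def Spow {n : ℕ} (S : Set ((Fin n → ℤ) × ℤ)) (k : ℕ) : Set (Fin n → ℝ) :=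
  {α | ∃ β : Fin n → ℤ, (∀ i, (β i : ℝ) = (k : ℝ) * α i) ∧ (β, (k : ℤ)) ∈ S}


/-- `Conv(S^k)`: the closed convex hull of `S^k` in `ℝ^n`. -/
def convSpow {n : ℕ} (S : Set ((Fin n → ℤ) × ℤ)) (k : ℕ) : Set (Fin n → ℝ) :=
  closure (convexHull ℝ (Spow S k))

lemma nsmul_mem_semigroup {n : ℕ} {S : Set ((Fin n → ℤ) × ℤ)}
    (hsemi : ∀ a ∈ S, ∀ b ∈ S, a + b ∈ S) {a : (Fin n → ℤ) × ℤ} (ha : a ∈ S)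
    (m : ℕ) : (m + 1) • a ∈ S := by
  induction m with
  | zero => simpa using ha
  | succ m ih => rw [succ_nsmul]; exact hsemi _ ih _ ha

lemma Spow_subset_mul {n : ℕ} {S : Set ((Fin n → ℤ) × ℤ)}
    (hsemi : ∀ a ∈ S, ∀ b ∈ S, a + b ∈ S) (k m : ℕ) (hm : 1 ≤ m) :
    Spow S k ⊆ Spow S (k * m) := by
  rintro α ⟨β, hβ, hS⟩
  obtain ⟨m, rfl⟩ : ∃ j, m = j + 1 := ⟨m - 1, by omega⟩
  refine ⟨(m + 1) • β, ?_, ?_⟩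
  · intro i
    simp only [Pi.smul_apply, nsmul_eq_mul]
    push_cast
    rw [hβ i]
    ring
  · have := nsmul_mem_semigroup hsemi hS m
    convert this using 1
    ext
    · simp
    · simp [mul_comm]

lemma Spow_subset_dvd {n : ℕ} {S : Set ((Fin n → ℤ) × ℤ)}
    (hsemi : ∀ a ∈ S, ∀ b ∈ S, a + b ∈ S) {k l : ℕ} (h : k ∣ l) (hl : 1 ≤ l) :
    Spow S k ⊆ Spow S l := by
  obtain ⟨m, rfl⟩ := h
  apply Spow_subset_mul hsemi
  rcases Nat.eq_zero_or_pos m with rfl | h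
  · simp at hl
  · exact h

lemma coneCombos_add {E : Type*} [AddCommMonoid E] [Module ℝ E] {T : Set E} {x y : E}
    (hx : x ∈ coneCombos T) (hy : y ∈ coneCombos T) : x + y ∈ coneCombos T := by
  obtain ⟨k, c, t, hc, ht, rfl⟩ := hx
  obtain ⟨l, d, u, hd, hu, rfl⟩ := hy
  refine ⟨k + l, Fin.append c d, Fin.append t u, ?_, ?_, ?_⟩
  · intro i
    refine Fin.addCases (fun i => ?_) (fun i => ?_) i
    · simpa using hc i
    · simpa using hd i
  · intro i
    refine Fin.addCases (fun i => ?_) (fun i => ?_) i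
    · simpa using ht i
    · simpa using hu i
  · simp [Fin.sum_univ_add]

lemma coneCombos_smul {E : Type*} [AddCommMonoid E] [Module ℝ E] {T : Set E} {x : E}
    (hx : x ∈ coneCombos T) {r : ℝ} (hr : 0 ≤ r) : r • x ∈ coneCombos T := by
  obtain ⟨k, c, t, hc, ht, rfl⟩ := hx
  refine ⟨k, fun i => r * c i, t, fun i => mul_nonneg hr (hc i), ht, ?_⟩
  simp [Finset.smul_sum, mul_smul]

lemma convex_coneCombos {E : Type*} [AddCommMonoid E] [Module ℝ E] (T : Set E) :
    Convex ℝ (coneCombos T) := by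
  intro x hx y hy a b ha hb _
  exact coneCombos_add (coneCombos_smul hx ha) (coneCombos_smul hy hb)

lemma okounkovSet_eq_preimage {n : ℕ} (S : Set ((Fin n → ℤ) × ℤ)) :
    okounkovSet S = (fun x : Fin n → ℝ => (x, (1 : ℝ))) ⁻¹' coneOf S := by
  ext x
  constructor
  · rintro ⟨⟨y, r⟩, ⟨hy, hr⟩, rfl⟩
    simp only [mem_ofPred_eq] at hr
    subst hr
    exact hy
  · intro h
    exact ⟨(x, 1), ⟨h, rfl⟩, rfl⟩

lemma convSpow_subset {n : ℕ} (S : Set ((Fin n → ℤ) × ℤ)) (k : ℕ) (hk : 1 ≤ k) :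
    convSpow S k ⊆ okounkovSet S := by
  have hk' : (0 : ℝ) < k := by exact_mod_cast hk
  have hcl : IsClosed (okounkovSet S) := by
    rw [okounkovSet_eq_preimage]
    exact isClosed_closure.preimage (by fun_prop)
  have hconv : Convex ℝ (okounkovSet S) := by
    rw [okounkovSet_eq_preimage]
    have h0 : Convex ℝ (coneOf S) := (convex_coneCombos _).closure
    intro x hx y hy a b ha hb hab
    have := h0 hx hy ha hb hab
    simpa [hab] using this
  refine closure_minimal (convexHull_min ?_ hconv) hcl
  rintro α ⟨β, hβ, hS⟩
  rw [okounkovSet_eq_preimage]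
  refine subset_closure ⟨1, fun _ => (k : ℝ)⁻¹, fun _ => latticeEmbed (β, (k : ℤ)),
    fun _ => by positivity, fun _ => ⟨_, hS, rfl⟩, ?_⟩
  ext i
  · simp [latticeEmbed, hβ i, hk'.ne']
  · simp [latticeEmbed, hk'.ne']

/-- The union of the convex hulls of all `S^k`. -/
def hullUnion {n : ℕ} (S : Set ((Fin n → ℤ) × ℤ)) : Set (Fin n → ℝ) :=
  {x | ∃ k : ℕ, 1 ≤ k ∧ x ∈ convexHull ℝ (Spow S k)}

lemma convex_hullUnion {n : ℕ} {S : Set ((Fin n → ℤ) × ℤ)}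
    (hsemi : ∀ a ∈ S, ∀ b ∈ S, a + b ∈ S) : Convex ℝ (hullUnion S) := by
  rintro x ⟨k, hk, hx⟩ y ⟨l, hl, hy⟩ a b ha hb hab
  have hkl : 1 ≤ k * l := Nat.mul_pos hk hl
  refine ⟨k * l, hkl, ?_⟩
  exact convex_convexHull ℝ _
    (convexHull_mono (Spow_subset_dvd hsemi (Dvd.intro _ rfl) hkl) hx)
    (convexHull_mono (Spow_subset_dvd hsemi (Dvd.intro_left _ rfl) hkl) hy) ha hb hab

lemma hullUnion_add_level_zero {n : ℕ} {S : Set ((Fin n → ℤ) × ℤ)}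
    (hsemi : ∀ a ∈ S, ∀ b ∈ S, a + b ∈ S) {t : Fin n → ℤ} (ht : (t, (0 : ℤ)) ∈ S)
    {a : Fin n → ℝ} (ha : a ∈ hullUnion S) {r : ℝ} (hr : 0 ≤ r) :
    a + r • (fun i => (t i : ℝ)) ∈ hullUnion S := by
  obtain ⟨k, hk, hx⟩ := ha
  have hk' : (0 : ℝ) < k := by exact_mod_cast hk
  refine ⟨k, hk, ?_⟩
  obtain ⟨j, hj⟩ := exists_nat_ge (r * k)
  set v : Fin n → ℝ := fun i => (t i : ℝ) with hv
  set q : ℝ := ((j : ℝ) + 1) / k with hq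
  have hq0 : 0 < q := by positivity
  have hrq : r ≤ q := by
    rw [hq, le_div_iff₀ hk']; linarith
  have hmem : a + q • v ∈ convexHull ℝ (Spow S k) := by
    have hsub : convexHull ℝ (Spow S k) ⊆ (fun z => z + q • v) ⁻¹' convexHull ℝ (Spow S k) := by
      refine convexHull_min ?_ ((convex_convexHull ℝ _).translate_preimage_left _)
      rintro α ⟨β, hβ, hS⟩
      refine subset_convexHull ℝ _ ⟨β + (j + 1) • t, ?_, ?_⟩
      · intro i
        have h1 : ((β + (j + 1) • t) i : ℤ) = β i + ((j : ℤ) + 1) * t i := by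
          simp
        rw [h1]
        simp only [Pi.add_apply, Pi.smul_apply, smul_eq_mul, hq, hv]
        push_cast
        rw [hβ i]
        field_simp
      · have := hsemi _ hS _ (nsmul_mem_semigroup hsemi ht j)
        convert this using 1
        ext <;> simp
    exact hsub hx
  have := convex_convexHull ℝ (Spow S k) hx hmem (a := 1 - r / q) (b := r / q)
    (by rw [sub_nonneg, div_le_one hq0]; exact hrq) (by positivity) (by ring)
  convert this using 1
  ext i
  simp only [Pi.add_apply, Pi.smul_apply, smul_eq_mul]
  field_simp
  ring

lemma coneCombos_key {n : ℕ} {S : Set ((Fin n → ℤ) × ℤ)}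
    (hsemi : ∀ a ∈ S, ∀ b ∈ S, a + b ∈ S) (hadm : ∀ a ∈ S, 0 ≤ a.2)
    {y : (Fin n → ℝ) × ℝ} (hy : y ∈ coneCombos (latticeEmbed '' S)) :
    0 ≤ y.2 ∧ ∀ a ∈ hullUnion S, ∀ e : ℝ, 0 < e →
      (e + y.2)⁻¹ • (e • a + y.1) ∈ hullUnion S := by
  obtain ⟨k, c, t, hc, ht, rfl⟩ := hy
  refine Finset.sum_induction (fun i => c i • t i) (fun y : (Fin n → ℝ) × ℝ =>
    0 ≤ y.2 ∧ ∀ a ∈ hullUnion S, ∀ e : ℝ, 0 < e →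
      (e + y.2)⁻¹ • (e • a + y.1) ∈ hullUnion S) ?_ ?_ ?_
  · rintro y z ⟨hy0, hy⟩ ⟨hz0, hz⟩
    refine ⟨add_nonneg hy0 hz0, fun a ha e he => ?_⟩
    have hpos : 0 < e + y.2 := by positivity
    have := hz _ (hy a ha e he) (e + y.2) hpos
    rw [smul_smul, mul_inv_cancel₀ hpos.ne', one_smul] at this
    simpa [add_assoc] using this
  · refine ⟨le_rfl, fun a ha e he => ?_⟩
    simpa [smul_smul, he.ne'] using ha
  · intro i _
    obtain ⟨⟨s, l⟩, hs, hst⟩ := ht i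
    have hl : 0 ≤ l := hadm _ hs
    obtain ⟨l, rfl⟩ := Int.eq_ofNat_of_zero_le hl
    have hci := hc i
    rw [← hst]
    generalize c i = r at hci
    refine ⟨by simp only [latticeEmbed, Prod.smul_snd, smul_eq_mul]; positivity, fun a ha e he => ?_⟩
    rcases Nat.eq_zero_or_pos l with rfl | hl
    · have := hullUnion_add_level_zero hsemi hs ha (r := e⁻¹ * r) (by positivity)
      convert this using 1
      ext i
      simp [latticeEmbed]
      field_simp
    · have hl' : (0 : ℝ) < l := by exact_mod_cast hl
      have hb : (fun i => (s i : ℝ) / l) ∈ hullUnion S := by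
        refine ⟨l, hl, subset_convexHull ℝ _ ⟨s, fun i => ?_, hs⟩⟩
        field_simp
      have hpos : 0 < e + r * l := by positivity
      have := convex_hullUnion hsemi ha hb (a := e / (e + r * l)) (b := r * l / (e + r * l))
        (by positivity) (by positivity) (by field_simp)
      convert this using 1
      ext i
      simp [latticeEmbed]
      field_simp

lemma hullUnion_nonempty {n : ℕ} {S : Set ((Fin n → ℤ) × ℤ)}
    (hadm : ∀ a ∈ S, 0 ≤ a.2)
    {y : (Fin n → ℝ) × ℝ} (hy : y ∈ coneCombos (latticeEmbed '' S)) (hy2 : 0 < y.2) :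
    (hullUnion S).Nonempty := by
  by_contra hne
  obtain ⟨k, c, t, hc, ht, rfl⟩ := hy
  rw [Prod.snd_sum] at hy2
  refine hy2.ne' (Finset.sum_eq_zero fun i _ => ?_)
  obtain ⟨⟨s, l⟩, hs, hst⟩ := ht i
  have hl : 0 ≤ l := hadm _ hs
  obtain ⟨l, rfl⟩ := Int.eq_ofNat_of_zero_le hl
  rcases Nat.eq_zero_or_pos l with rfl | hl
  · simp [← hst, latticeEmbed]
  · have hl' : (0 : ℝ) < l := by exact_mod_cast hl
    exact (hne ⟨(fun i => (s i : ℝ) / l), l, hl,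
      subset_convexHull ℝ _ ⟨s, fun i => by field_simp, hs⟩⟩).elim

lemma okounkovSet_subset_closure {n : ℕ} {S : Set ((Fin n → ℤ) × ℤ)}
    (hsemi : ∀ a ∈ S, ∀ b ∈ S, a + b ∈ S) (hadm : ∀ a ∈ S, 0 ≤ a.2) :
    okounkovSet S ⊆ closure (hullUnion S) := by
  have hcone : ∀ y ∈ coneCombos (latticeEmbed '' S), 0 < y.2 →
      y.2⁻¹ • y.1 ∈ closure (hullUnion S) := by
    intro y hy hy2
    obtain ⟨a, ha⟩ := hullUnion_nonempty hadm hy hy2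
    have hk := (coneCombos_key hsemi hadm hy).2 a ha
    have hlim : Filter.Tendsto (fun e : ℝ => (e + y.2)⁻¹ • (e • a + y.1))
        (nhdsWithin 0 (Ioi 0)) (nhds (y.2⁻¹ • y.1)) := by
      have : ContinuousAt (fun e : ℝ => (e + y.2)⁻¹ • (e • a + y.1)) 0 := by
        have c1 : ContinuousAt (fun e : ℝ => (e + y.2)⁻¹) 0 :=
          ContinuousAt.inv₀ (f := fun e : ℝ => e + y.2) (by fun_prop) (by simpa using hy2.ne')
        have c2 : ContinuousAt (fun e : ℝ => e • a + y.1) 0 := by fun_prop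
        exact c1.smul c2
      have h2 := this.tendsto
      simp only [zero_add, zero_smul] at h2
      exact h2.mono_left nhdsWithin_le_nhds
    refine mem_closure_of_tendsto hlim ?_
    filter_upwards [self_mem_nhdsWithin] with e he
    exact hk e he
  intro x hx
  rw [okounkovSet_eq_preimage] at hx
  have hx' : (x, (1 : ℝ)) ∈ closure (coneCombos (latticeEmbed '' S)) := hx
  rw [mem_closure_iff_seq_limit] at hx'
  obtain ⟨u, hu, hlim⟩ := hx'
  have h1 : Filter.Tendsto (fun j => (u j).1) Filter.atTop (nhds x) :=
    (continuous_fst.tendsto _).comp hlim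
  have h2 : Filter.Tendsto (fun j => (u j).2) Filter.atTop (nhds 1) :=
    (continuous_snd.tendsto _).comp hlim
  have h3 : Filter.Tendsto (fun j => (u j).2⁻¹ • (u j).1) Filter.atTop (nhds x) := by
    simpa using (h2.inv₀ one_ne_zero).smul h1
  refine isClosed_closure.mem_of_tendsto h3 ?_
  filter_upwards [h2.eventually (lt_mem_nhds (zero_lt_one))] with j hj
  exact hcone _ (hu j) hj

lemma interior_closure_subset_of_convex {n : ℕ} {A : Set (Fin n → ℝ)} (hA : Convex ℝ A) :
    interior (closure A) ⊆ interior A := by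
  intro x hx
  have htop : affineSpan ℝ (closure A) = ⊤ := affineSpan_eq_top_of_nonempty_interior
    ⟨x, interior_mono (subset_convexHull ℝ _) hx⟩
  have hcl : closure A ⊆ (affineSpan ℝ A : Set (Fin n → ℝ)) :=
    closure_minimal (subset_affineSpan ℝ A) (AffineSubspace.closed_of_finiteDimensional _)
  have h2 : affineSpan ℝ A = ⊤ := by
    rw [eq_top_iff, ← htop]
    exact affineSpan_le.2 hcl
  have hne := hA.interior_nonempty_iff_affineSpan_eq_top.2 h2
  rwa [hA.interior_closure_eq_interior_of_nonempty_interior hne] at hx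

lemma interior_okounkovSet_subset {n : ℕ} {S : Set ((Fin n → ℤ) × ℤ)}
    (hsemi : ∀ a ∈ S, ∀ b ∈ S, a + b ∈ S) (hadm : ∀ a ∈ S, 0 ≤ a.2)
    {x : Fin n → ℝ} (hx : x ∈ interior (okounkovSet S)) :
    ∃ k : ℕ, 1 ≤ k ∧ x ∈ interior (convSpow S (Nat.factorial k)) := by
  have hx' : x ∈ interior (hullUnion S) := interior_closure_subset_of_convex
    (convex_hullUnion hsemi) (interior_mono (okounkovSet_subset_closure hsemi hadm) hx)
  obtain ⟨b, hb, hbA⟩ := exists_mem_interior_convexHull_affineBasis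
    (mem_interior_iff_mem_nhds.1 hx')
  have hbi : ∀ i, b i ∈ hullUnion S := fun i => hbA (subset_convexHull ℝ _ ⟨i, rfl⟩)
  choose k hk hbk using hbi
  have hK : 0 < ∏ i, k i := Finset.prod_pos fun i _ => hk i
  refine ⟨∏ i, k i, hK, interior_mono ?_ hb⟩
  refine (convexHull_min ?_ (convex_convexHull ℝ _)).trans subset_closure
  rintro _ ⟨i, rfl⟩
  refine convexHull_mono (Spow_subset_dvd hsemi ?_ (Nat.factorial_pos _)) (hbk i)
  exact (Finset.dvd_prod_of_mem k (Finset.mem_univ i)).trans (Nat.dvd_factorial hK le_rfl)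

/-- For an admissible additive subsemigroup `S ⊆ ℤ^n × ℤ`, the sets
`Conv(S^{k!})` are nondecreasing in `k`, and the interior of `Δ(S)` equals both
`⋃_{k ≥ 1} interior(Conv(S^k))` and `⋃_{k ≥ 1} interior(Conv(S^{k!}))`. -/
theorem interior_okounkovSet_eq_iUnion (n : ℕ) (hn : 1 ≤ n)
    (S : Set ((Fin n → ℤ) × ℤ))
    (hsemi : ∀ a ∈ S, ∀ b ∈ S, a + b ∈ S)
    (hadm : ∀ a ∈ S, 0 ≤ a.2) :
    (∀ k l : ℕ, 1 ≤ k → k ≤ l →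
      convSpow S (Nat.factorial k) ⊆ convSpow S (Nat.factorial l)) ∧
    (interior (okounkovSet S) =
      ⋃ k : ℕ, ⋃ (_ : 1 ≤ k), interior (convSpow S k)) ∧
    (interior (okounkovSet S) =
      ⋃ k : ℕ, ⋃ (_ : 1 ≤ k), interior (convSpow S (Nat.factorial k))) := by
  have hsub : ∀ k, 1 ≤ k → interior (convSpow S k) ⊆ interior (okounkovSet S) :=
    fun k hk => interior_mono (convSpow_subset S k hk)
  refine ⟨?_, ?_, ?_⟩
  · intro k l _ hkl
    exact closure_mono (convexHull_mono
      (Spow_subset_dvd hsemi (Nat.factorial_dvd_factorial hkl) (Nat.factorial_pos _)))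
  · refine Subset.antisymm ?_ (iUnion₂_subset hsub)
    intro x hx
    obtain ⟨k, _, h⟩ := interior_okounkovSet_subset hsemi hadm hx
    exact mem_iUnion₂.2 ⟨Nat.factorial k, Nat.factorial_pos k, h⟩
  · refine Subset.antisymm ?_ (iUnion₂_subset fun k _ => hsub _ (Nat.factorial_pos k))
    intro x hx
    obtain ⟨k, hk, h⟩ := interior_okounkovSet_subset hsemi hadm hx
    exact mem_iUnion₂.2 ⟨k, hk, h⟩
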